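/- Let G be a finite bipartite simple graph with q ≥ 1 edges and bipartition V(G) = X ∪ Y (every edge has one end in X and one end in Y), and let f be a set-ordered graceful labeling of G. Define g : V(G) → ℕ by g(u) = 2f(u) for u ∈ X and g(v) = 2f(v) − 1 for v ∈ Y. Then g is a set-ordered odd-graceful labeling of G: g is injective, takes values in {1, …, 2q+1}, its induced edge labels form exactly the set {1, 3, …, 2q−1}, and max g(X) < min g(Y). -/

import Mathlib

/-- From a set-ordered graceful labeling `f` of a bipartite graph `G` with parts `X, Y`,
the labeling `g` with `g(u) = 2f(u)` on `X` and `g(v) = 2f(v) − 1` on `Y` is a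
set-ordered odd-graceful labeling of `G`. -/
theorem set_ordered_graceful_to_odd_graceful {V : Type*} [Fintype V]
    (G : SimpleGraph V) (q : ℕ) (hq : 1 ≤ q)
    [DecidableRel G.Adj] (hGq : G.edgeFinset.card = q)
    (X Y : Set V) (hunion : X ∪ Y = Set.univ) (hdisj : Disjoint X Y)
    (hbip : ∀ u v : V, G.Adj u v → (u ∈ X ∧ v ∈ Y) ∨ (u ∈ Y ∧ v ∈ X))
    (f : V → ℕ) (hfinj : Function.Injective f)
    (hfrange : ∀ v : V, f v ∈ Set.Icc 1 (q + 1))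
    (hfedge : {n : ℤ | ∃ u v : V, G.Adj u v ∧ n = |(f u : ℤ) - (f v : ℤ)|}
              = Set.Icc (1 : ℤ) q)
    (hford : ∀ x ∈ X, ∀ y ∈ Y, f x < f y)
    (g : V → ℕ)
    (hgX : ∀ u ∈ X, g u = 2 * f u)
    (hgY : ∀ v ∈ Y, g v = 2 * f v - 1) :
    Function.Injective g ∧
    (∀ v : V, g v ∈ Set.Icc 1 (2 * q + 1)) ∧
    ({n : ℤ | ∃ u v : V, G.Adj u v ∧ n = |(g u : ℤ) - (g v : ℤ)|}
      = {n : ℤ | ∃ k : ℕ, k < q ∧ n = 2 * (k : ℤ) + 1}) ∧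
    (∀ x ∈ X, ∀ y ∈ Y, g x < g y) := by
  have hmem (v : V) : v ∈ X ∨ v ∈ Y := by
    rw [← Set.mem_union, hunion]
    trivial
  have hpos (v : V) : 1 ≤ f v := (hfrange v).1
  have hle (v : V) : f v ≤ q + 1 := (hfrange v).2
  have hYne : ∃ y, y ∈ Y := by
    have h1 : (1 : ℤ) ∈ Set.Icc (1 : ℤ) q := ⟨le_rfl, by exact_mod_cast hq⟩
    rw [← hfedge] at h1
    obtain ⟨u, v, huv, -⟩ := h1
    rcases hbip u v huv with h | h
    · exact ⟨v, h.2⟩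
    · exact ⟨u, h.1⟩
  have hlabel (u v : V) (huv : G.Adj u v) :
      |(g u : ℤ) - g v| = 2 * |(f u : ℤ) - f v| - 1 := by
    rcases hbip u v huv with ⟨hu, hv⟩ | ⟨hu, hv⟩
    · have hlt := hford u hu v hv
      have hgu := hgX u hu
      have hgv := hgY v hv
      rw [abs_of_neg (by omega), abs_of_neg (by omega)]
      omega
    · have hlt := hford v hv u hu
      have hgu := hgY u hu
      have hgv := hgX v hv
      rw [abs_of_pos (by omega), abs_of_pos (by omega)]
      omega
  refine ⟨fun u v huv => hfinj ?_, fun v => ?_, ?_, fun x hx y hy => ?_⟩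
  · have hu := hpos u
    have hv := hpos v
    rcases hmem u with h | h <;> rcases hmem v with h' | h' <;>
      simp only [hgX, hgY, h, h'] at huv <;> omega
  · have hv := hpos v
    have hv' := hle v
    rw [Set.mem_Icc]
    rcases hmem v with h | h
    · obtain ⟨y, hy⟩ := hYne
      have hlt := hford v h y hy
      have hy' := hle y
      rw [hgX v h]
      omega
    · rw [hgY v h]
      omega
  · ext n
    constructor
    · rintro ⟨u, v, huv, rfl⟩
      have hm : |(f u : ℤ) - f v| ∈ Set.Icc (1 : ℤ) q := hfedge ▸ ⟨u, v, huv, rfl⟩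
      obtain ⟨h1, h2⟩ := hm
      have hl := hlabel u v huv
      refine ⟨(|(f u : ℤ) - f v| - 1).toNat, ?_, ?_⟩ <;> omega
    · rintro ⟨k, hk, rfl⟩
      have hm : (k : ℤ) + 1 ∈ Set.Icc (1 : ℤ) q := ⟨by omega, by omega⟩
      rw [← hfedge] at hm
      obtain ⟨u, v, huv, hn⟩ := hm
      exact ⟨u, v, huv, by rw [hlabel u v huv, ← hn]; ring⟩
  · have hlt := hford x hx y hy
    rw [hgX x hx, hgY y hy]
    omega
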